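/- Let m and p be integers with 0 ≤ p and p + 1 ≤ m. The quotient ring ℤ[k,η]/((k−η)^(m−p), k^(p+1)·η) is a free ℤ-module of rank (m−p)·(p+2). (This is the additive structure of the classical cohomology ring of the blow-up of ℙ^m along a p-dimensional linear subspace, presented with generators k (hyperplane class) and η (exceptional divisor) and relations g₁ = (k−η)^(m−p), g₂ = k^(p+1)·η.) -/

import Mathlib

open MvPolynomial

/-- The ideal `((k−η)^(m−p), k^(p+1)·η)` of `ℤ[k,η]` (with `k = X 0`, `η = X 1`):
the classical cohomology relations of the blow-up of `ℙ^m` along a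
`p`-dimensional linear subspace. -/
noncomputable def blowupIdeal (m p : ℕ) : Ideal (MvPolynomial (Fin 2) ℤ) :=
  Ideal.span {(X 0 - X 1) ^ (m - p), X 0 ^ (p + 1) * X 1}


/-- The base ring `ℤ[t]/(t^n)`, where `t` stands for `k - η`. -/
noncomputable abbrev BaseRing (n : ℕ) : Type := AdjoinRoot (Polynomial.X ^ n : Polynomial ℤ)

/-- The polynomial `k^(p+1) (k - t)` over the base ring. -/
noncomputable abbrev topPoly (n p : ℕ) : Polynomial (BaseRing n) :=
  Polynomial.X ^ (p + 1) * (Polynomial.X - Polynomial.C (AdjoinRoot.root _))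

noncomputable abbrev TowerRing (n p : ℕ) : Type := AdjoinRoot (topPoly n p)

lemma base_rel (n : ℕ) : (AdjoinRoot.root (Polynomial.X ^ n : Polynomial ℤ)) ^ n = 0 := by
  have h := AdjoinRoot.mk_self (f := (Polynomial.X ^ n : Polynomial ℤ))
  simpa only [map_pow, AdjoinRoot.mk_X] using h

lemma tower_rel (n p : ℕ) : (AdjoinRoot.root (topPoly n p)) ^ (p + 1) *
    (AdjoinRoot.root (topPoly n p) - AdjoinRoot.of (topPoly n p) (AdjoinRoot.root _)) = 0 := by
  have h := AdjoinRoot.mk_self (f := topPoly n p)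
  simpa only [topPoly, map_mul, map_sub, map_pow, AdjoinRoot.mk_X, AdjoinRoot.mk_C] using h

noncomputable def toTower (m p : ℕ) :
    (MvPolynomial (Fin 2) ℤ ⧸ blowupIdeal m p) →+* TowerRing (m - p) p :=
  Ideal.Quotient.lift (blowupIdeal m p)
    (aeval (R := ℤ) ![AdjoinRoot.root (topPoly (m - p) p), AdjoinRoot.root (topPoly (m - p) p) -
      AdjoinRoot.of (topPoly (m - p) p) (AdjoinRoot.root _)]).toRingHom (by
    have h : blowupIdeal m p ≤ RingHom.ker (aeval (R := ℤ)
        ![AdjoinRoot.root (topPoly (m - p) p), AdjoinRoot.root (topPoly (m - p) p) -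
        AdjoinRoot.of (topPoly (m - p) p) (AdjoinRoot.root _)]).toRingHom := by
      rw [blowupIdeal, Ideal.span_le]
      rintro x (rfl | rfl)
      · have h0 := congrArg (AdjoinRoot.of (topPoly (m - p) p)) (base_rel (m - p))
        rw [map_pow, map_zero] at h0
        simpa [RingHom.mem_ker] using h0
      · simpa [RingHom.mem_ker] using tower_rel (m - p) p
    exact fun a ha => h ha)

lemma quot_rel1 (m p : ℕ) : (Ideal.Quotient.mk (blowupIdeal m p) (X 0 - X 1)) ^ (m - p) = 0 := by
  rw [← map_pow, Ideal.Quotient.eq_zero_iff_mem]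
  exact Ideal.subset_span (by simp)

lemma quot_rel2 (m p : ℕ) : (Ideal.Quotient.mk (blowupIdeal m p) (X 0)) ^ (p + 1) *
    Ideal.Quotient.mk (blowupIdeal m p) (X 1) = 0 := by
  rw [← map_pow, ← map_mul, Ideal.Quotient.eq_zero_iff_mem]
  exact Ideal.subset_span (by simp)

noncomputable def fromBase (m p : ℕ) :
    BaseRing (m - p) →+* (MvPolynomial (Fin 2) ℤ ⧸ blowupIdeal m p) :=
  AdjoinRoot.lift (Int.castRingHom _) (Ideal.Quotient.mk (blowupIdeal m p) (X 0 - X 1)) (by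
    rw [Polynomial.eval₂_pow, Polynomial.eval₂_X, quot_rel1])

noncomputable def fromTower (m p : ℕ) :
    TowerRing (m - p) p →+* (MvPolynomial (Fin 2) ℤ ⧸ blowupIdeal m p) :=
  AdjoinRoot.lift (fromBase m p) (Ideal.Quotient.mk (blowupIdeal m p) (X 0)) (by
    rw [Polynomial.eval₂_mul, Polynomial.eval₂_pow, Polynomial.eval₂_sub, Polynomial.eval₂_X,
      Polynomial.eval₂_C, fromBase, AdjoinRoot.lift_root, ← map_sub, sub_sub_cancel, quot_rel2])

lemma from_to (m p : ℕ) : (fromTower m p).comp (toTower m p) = RingHom.id _ := by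
  apply Ideal.Quotient.ringHom_ext
  apply MvPolynomial.ringHom_ext
  · intro r; simp
  · intro i
    fin_cases i <;> simp [toTower, fromTower, fromBase]

lemma to_from (m p : ℕ) : (toTower m p).comp (fromTower m p) = RingHom.id _ := by
  apply AdjoinRoot.ringHom_ext
  · apply AdjoinRoot.ringHom_ext
    · exact RingHom.ext_int _ _
    · simp [toTower, fromTower, fromBase]
  · simp [toTower, fromTower]

noncomputable def towerEquiv (m p : ℕ) :
    (MvPolynomial (Fin 2) ℤ ⧸ blowupIdeal m p) ≃+* TowerRing (m - p) p :=
  RingEquiv.ofRingHom (toTower m p) (fromTower m p) (to_from m p) (from_to m p)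

lemma topPoly_monic (n p : ℕ) : (topPoly n p).Monic :=
  (Polynomial.monic_X_pow _).mul (Polynomial.monic_X_sub_C _)

/-- The classical cohomology ring `ℤ[k,η]/((k−η)^(m−p), k^(p+1)η)` of the
blow-up is a free `ℤ`-module of rank `(m−p)·(p+2)`. -/
theorem classical_cohomology_free_rank (m p : ℕ) (hp : 0 ≤ p) (hm : p + 1 ≤ m) :
    Module.Free ℤ (MvPolynomial (Fin 2) ℤ ⧸ blowupIdeal m p) ∧
      Module.finrank ℤ (MvPolynomial (Fin 2) ℤ ⧸ blowupIdeal m p) = (m - p) * (p + 2) := by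
  have hn : m - p ≠ 0 := by omega
  have hmon : (Polynomial.X ^ (m - p) : Polynomial ℤ).Monic := Polynomial.monic_X_pow _
  haveI : Nontrivial (BaseRing (m - p)) := AdjoinRoot.nontrivial _ (by simpa using hn)
  let b := AdjoinRoot.powerBasisAux' hmon
  let c := AdjoinRoot.powerBasisAux' (topPoly_monic (m - p) p)
  let e : (MvPolynomial (Fin 2) ℤ ⧸ blowupIdeal m p) ≃ₗ[ℤ] TowerRing (m - p) p :=
    (towerEquiv m p).toAddEquiv.toIntLinearEquiv
  let d := (b.smulTower c).map e.symm
  refine ⟨Module.Free.of_basis d, ?_⟩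
  rw [Module.finrank_eq_card_basis d, Fintype.card_prod, Fintype.card_fin, Fintype.card_fin,
    Polynomial.natDegree_X_pow, (Polynomial.monic_X_pow _).natDegree_mul
      (Polynomial.monic_X_sub_C _), Polynomial.natDegree_X_pow, Polynomial.natDegree_X_sub_C]
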